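/- Let V be an N-dimensional vector space over a non-Archimedean field K, and for a norm ‖·‖ on V define the determinant norm on Λ^N V by ‖τ‖_det = inf{‖v₁‖⋯‖v_N‖ : τ = v₁ ∧ ⋯ ∧ v_N}. If 𝒱₁ ⊇ 𝒱₂ are lattices in V with associated lattice norms ‖·‖_{𝒱₁}, ‖·‖_{𝒱₂}, then log(det‖·‖_{𝒱₂} / det‖·‖_{𝒱₁}) = ℓ(𝒱₁/𝒱₂), the content of the finitely presented torsion module 𝒱₁/𝒱₂. -/

import Mathlib

open scoped Pointwise
set_option maxHeartbeats 1000000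
set_option synthInstance.maxHeartbeats 1000000

instance stmt7PiInst (K : Type) [NontriviallyNormedField K] (R : Subring K)
    (k : ℕ) (a : Fin k → R) :
    Module R ((i : Fin k) → R ⧸ Ideal.span {a i}) := Pi.module _ _ _

section
open Module

theorem aux_free {R : Type} [CommRing R] [IsDomain R] [ValuationRing R] (M : Type)
    [AddCommGroup M] [Module R M] [Module.Finite R M] [Module.IsTorsionFree R M] :
    Module.Free R M := by
  have : Module.Flat R M := by
    rw [Module.Flat.flat_iff_torsion_eq_bot_of_isBezout,
      ← Submodule.isTorsionFree_iff_torsion_eq_bot]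
    infer_instance
  exact Module.free_of_flat_of_isLocalRing

theorem aux_min {R : Type} [CommRing R] [IsDomain R] [ValuationRing R] {ι : Type} (f : ι → R)
    (s : Finset ι) (h : s.Nonempty) : ∃ a ∈ s, ∀ b ∈ s, f a ∣ f b := by
  classical
  induction h using Finset.Nonempty.cons_induction with
  | singleton a => exact ⟨a, by simp, by simp⟩
  | cons a s ha hs ih =>
    obtain ⟨c, hc, hc'⟩ := ih
    rcases (ValuationRing.iff_dvd_total.1 inferInstance : Std.Total fun x y : R => x ∣ y).total
      (f a) (f c) with h | h
    · refine ⟨a, by simp, fun b hb => ?_⟩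
      rcases Finset.mem_cons.1 hb with rfl | hb
      · exact dvd_rfl
      · exact h.trans (hc' b hb)
    · refine ⟨c, by simp [hc], fun b hb => ?_⟩
      rcases Finset.mem_cons.1 hb with rfl | hb
      · exact h
      · exact hc' b hb

theorem aux_equiv (n : ℕ) (i : Fin (n+1)) :
    ∃ e : Unit ⊕ Fin n ≃ Fin (n+1), e (Sum.inl ()) = i := by
  have e0 : Unit ⊕ Fin n ≃ Fin (n+1) := Fintype.equivOfCardEq (by simp [add_comm])
  exact ⟨e0.trans (Equiv.swap (e0 (Sum.inl ())) i), by simp⟩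

theorem aux_smith {R : Type} [CommRing R] [IsDomain R] [ValuationRing R] (n : ℕ) :
    ∀ A : Matrix (Fin n) (Fin n) R, ∃ P Q : Matrix (Fin n) (Fin n) R, ∃ D : Fin n → R,
      IsUnit P ∧ IsUnit Q ∧ P * A * Q = Matrix.diagonal D := by
  induction n with
  | zero => exact fun A => ⟨1, 1, 0, isUnit_one, isUnit_one, Subsingleton.elim _ _⟩
  | succ n ih =>
    intro A
    obtain ⟨⟨i, j⟩, -, hij⟩ := aux_min (fun p : Fin (n+1) × Fin (n+1) => A p.1 p.2)
      Finset.univ Finset.univ_nonempty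
    have hij' : ∀ k l, A i j ∣ A k l := fun k l => hij (k, l) (Finset.mem_univ _)
    choose q hq using hij'
    obtain ⟨e1, he1⟩ := aux_equiv n i
    obtain ⟨e2, he2⟩ := aux_equiv n j
    let r : Matrix Unit (Fin n) R := Matrix.of fun _ l => q i (e2 (Sum.inr l))
    let c : Matrix (Fin n) Unit R := Matrix.of fun k _ => q (e1 (Sum.inr k)) j
    let B : Matrix (Fin n) (Fin n) R := Matrix.of fun k l => A (e1 (Sum.inr k)) (e2 (Sum.inr l))
    let d : Matrix Unit Unit R := Matrix.of fun _ _ => A i j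
    have hA : A.submatrix e1 e2 = Matrix.fromBlocks d (d * r) (c * d) B := by
      ext (k | k) (l | l)
      · simp [d, he1, he2]
      · simp [d, r, he1, Matrix.mul_apply, ← hq]
      · simp [d, c, he2, Matrix.mul_apply, mul_comm (q _ _) , ← hq]
      · simp [B]
    obtain ⟨P, Q, D, hP, hQ, hD⟩ := ih (B - c * d * r)
    let P' := Matrix.fromBlocks (1 : Matrix Unit Unit R) 0 (-(P * c)) P
    let Q' := Matrix.fromBlocks (1 : Matrix Unit Unit R) (-(r * Q)) 0 Q
    have key : P' * A.submatrix e1 e2 * Q' =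
        Matrix.diagonal (Sum.elim (fun _ => A i j) D) := by
      rw [← Matrix.fromBlocks_diagonal, ← hD, hA]
      simp only [P', Q', Matrix.fromBlocks_multiply]
      congr 1
      · ext; simp [d, Matrix.diagonal]
      · simp [Matrix.mul_assoc]
      · simp [Matrix.mul_assoc]
      · simp only [Matrix.mul_sub, Matrix.sub_mul, Matrix.mul_neg, Matrix.neg_mul, Matrix.add_mul,
          Matrix.mul_assoc]
        abel
    refine ⟨P'.submatrix e1.symm e1.symm, Q'.submatrix e2.symm e1.symm,
      Sum.elim (fun _ => A i j) D ∘ e1.symm, ?_, ?_, ?_⟩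
    · rw [Matrix.isUnit_submatrix_equiv]
      exact Matrix.isUnit_fromBlocks_zero₁₂.2 ⟨isUnit_one, hP⟩
    · rw [Matrix.isUnit_submatrix_equiv]
      exact Matrix.isUnit_fromBlocks_zero₂₁.2 ⟨isUnit_one, hQ⟩
    · have h2 : A = (A.submatrix e1 e2).submatrix e1.symm e2.symm := by
        ext; simp
      conv_lhs => rw [h2]
      rw [Matrix.submatrix_mul_equiv, Matrix.submatrix_mul_equiv, key,
        Matrix.submatrix_diagonal_equiv]

theorem aux_bases {R : Type} [CommRing R] [IsDomain R] [ValuationRing R] {n : ℕ}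
    {M₁ M₂ : Type} [AddCommGroup M₁] [Module R M₁] [AddCommGroup M₂] [Module R M₂]
    (b₁ : Basis (Fin n) R M₁) (b₂ : Basis (Fin n) R M₂) (f : M₂ →ₗ[R] M₁) :
    ∃ (e₁ : Basis (Fin n) R M₁) (e₂ : Basis (Fin n) R M₂) (a : Fin n → R),
      ∀ i, f (e₂ i) = a i • e₁ i := by
  obtain ⟨P, Q, D, hP, hQ, hD⟩ := aux_smith n (LinearMap.toMatrix b₂ b₁ f)
  have hP' := (Matrix.isUnit_iff_isUnit_det P).1 hP
  have hPi : IsUnit (P⁻¹).det := by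
    rw [← Matrix.isUnit_iff_isUnit_det]; exact (Matrix.isUnit_nonsing_inv_iff).2 hP
  refine ⟨b₁.map (Matrix.toLinearEquiv b₁ P⁻¹ hPi),
    b₂.map (Matrix.toLinearEquiv b₂ Q ((Matrix.isUnit_iff_isUnit_det Q).1 hQ)), D, fun i => ?_⟩
  have h1 : LinearMap.toMatrix b₂ b₁ f * Q = P⁻¹ * Matrix.diagonal D := by
    rw [← hD, Matrix.mul_assoc, ← Matrix.mul_assoc P⁻¹, Matrix.nonsing_inv_mul _ hP', Matrix.one_mul]
  rw [Basis.map_apply, Basis.map_apply, Matrix.toLinearEquiv_apply, Matrix.toLinearEquiv_apply]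
  conv_lhs => rw [← Matrix.toLin_toMatrix b₂ b₁ f]
  rw [← Matrix.toLin_mul_apply, h1, Matrix.toLin_mul_apply b₂ b₁ b₁, ← map_smul,
    Matrix.toLin_self b₂ b₁]
  congr 1
  simp [Matrix.diagonal_apply]

theorem aux_alt {K : Type} [Field K] {V W : Type} [AddCommGroup V] [Module K V]
    [AddCommGroup W] [Module K W] {N : ℕ} (b : Basis (Fin N) K V) (f : V [⋀^Fin N]→ₗ[K] W)
    (v : Fin N → V) : f v = b.det v • f b := by
  have : f = (LinearMap.toSpanSingleton K W (f b)).compAlternatingMap b.det := by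
    apply Basis.ext_alternating b
    intro v hv
    let σ : Equiv.Perm (Fin N) := Equiv.ofBijective v (Finite.injective_iff_bijective.mp hv)
    change f (b ∘ σ) = b.det (b ∘ σ) • f b
    rw [AlternatingMap.map_perm, AlternatingMap.map_perm, Basis.det_self, smul_assoc, one_smul]
  conv_lhs => rw [this]
  simp

theorem aux_detnorm {K : Type} [NontriviallyNormedField K] [IsUltrametricDist K]
    (R : Subring K) (hR : ∀ x : K, x ∈ R ↔ ‖x‖ ≤ 1)
    {V : Type} [AddCommGroup V] [Module K V] {N : ℕ} (b : Basis (Fin (N+1)) K V)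
    (L : Submodule R V) (hL : L = Submodule.span R (Set.range b))
    (ν : V → ℝ) (hν : ∀ v : V, ν v = sInf {c : ℝ | ∃ α : K, v ∈ α • (L : Set V) ∧ c = ‖α‖})
    (τ : ExteriorAlgebra K V) (c : K) (hτ : τ = c • ExteriorAlgebra.ιMulti K (N+1) b) :
    sInf {x : ℝ | ∃ v : Fin (N+1) → V,
      τ = ExteriorAlgebra.ιMulti K (N+1) v ∧ x = ∏ i, ν (v i)} = ‖c‖ := by
  have hmem : ∀ v : V, v ∈ L ↔ ∀ i, ‖b.repr v i‖ ≤ 1 := by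
    intro v
    rw [hL, Basis.mem_span_iff_repr_mem]
    refine forall_congr' fun i => ?_
    rw [← hR]
    exact ⟨fun ⟨x, hx⟩ => hx ▸ x.2, fun h => ⟨⟨_, h⟩, rfl⟩⟩
  have hν0 : ∀ v, 0 ≤ ν v := by
    intro v
    rw [hν]
    apply Real.sInf_nonneg
    rintro _ ⟨α, -, rfl⟩
    exact norm_nonneg _
  have hle : ∀ (v : V) (α : K), v ∈ L → ν (α • v) ≤ ‖α‖ := by
    intro v α hv
    rw [hν]
    refine csInf_le ⟨0, ?_⟩ ⟨α, ⟨v, hv, rfl⟩, rfl⟩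
    rintro _ ⟨α, -, rfl⟩
    exact norm_nonneg _
  have hb : ∀ i, b i ∈ L := fun i => hL ▸ Submodule.subset_span ⟨i, rfl⟩
  have hge : ∀ (v : V) i, ‖b.repr v i‖ ≤ ν v := by
    intro v i
    rw [hν]
    refine le_csInf ?_ ?_
    · obtain ⟨j, -, hj⟩ := Finset.exists_max_image Finset.univ (fun i => ‖b.repr v i‖)
        Finset.univ_nonempty
      by_cases h0 : b.repr v j = 0
      · have : v = 0 := by
          apply b.ext_elem
          intro i
          have := hj i (Finset.mem_univ _)
          rw [h0] at this
          simpa using this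
        refine ⟨_, 0, ⟨0, L.zero_mem, ?_⟩, rfl⟩
        simp [this]
      · refine ⟨_, b.repr v j, ⟨(b.repr v j)⁻¹ • v, ?_, ?_⟩, rfl⟩
        · refine (hmem _).2 fun i => ?_
          have := hj i (Finset.mem_univ _)
          rw [map_smul, Finsupp.smul_apply, norm_smul, norm_inv,
            inv_mul_le_iff₀ (norm_pos_iff.2 h0), mul_one]
          exact this
        · simp [smul_smul, h0]
    · rintro _ ⟨α, ⟨w, hw, rfl⟩, rfl⟩
      have := (hmem w).1 hw i
      simp only [map_smul, Finsupp.smul_apply, norm_smul]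
      exact mul_le_of_le_one_right (norm_nonneg _) this
  have hdet : ∀ v : Fin (N+1) → V, ‖b.det v‖ ≤ ∏ i, ν (v i) := by
    intro v
    rw [Basis.det_apply, Matrix.det_apply]
    refine IsUltrametricDist.norm_sum_le_of_forall_le_of_nonneg
      (Finset.prod_nonneg fun i _ => hν0 _) fun σ _ => ?_
    have : ‖Equiv.Perm.sign σ • ∏ i, b.toMatrix v (σ i) i‖ = ∏ i, ‖b.toMatrix v (σ i) i‖ := by
      rcases Int.units_eq_one_or (Equiv.Perm.sign σ) with h | h <;> simp [h]
    rw [this]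
    exact Finset.prod_le_prod (fun _ _ => norm_nonneg _) fun i _ => hge _ _
  have hlow : ∀ v : Fin (N+1) → V, τ = ExteriorAlgebra.ιMulti K (N+1) v → b.det v = c := by
    intro v hv
    let F : (i : ℕ) → V [⋀^Fin i]→ₗ[K] K := fun i =>
      if h : i = N+1 then (h ▸ b.det : V [⋀^Fin i]→ₗ[K] K) else 0
    have hF : F (N+1) = b.det := by simp [F]
    have h := congrArg (ExteriorAlgebra.liftAlternating F) (hτ.symm.trans hv)
    rw [map_smul, ExteriorAlgebra.liftAlternating_apply_ιMulti,
      ExteriorAlgebra.liftAlternating_apply_ιMulti, hF, b.det_self] at h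
    simpa using h.symm
  have hex : τ = ExteriorAlgebra.ιMulti K (N+1) (fun i => (if i = 0 then c else 1) • b i) := by
    rw [AlternatingMap.map_smul_univ, hτ]
    simp
  apply le_antisymm
  · refine le_trans (csInf_le ⟨0, ?_⟩ ⟨_, hex, rfl⟩) ?_
    · rintro _ ⟨v, -, rfl⟩
      exact Finset.prod_nonneg fun i _ => hν0 _
    · refine (Finset.prod_le_prod (fun i _ => hν0 _) fun i _ => hle _ _ (hb i)).trans ?_
      rw [← norm_prod]
      simp
  · refine le_csInf ?_ ?_
    · exact ⟨_, _, hex, rfl⟩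
    rintro _ ⟨v, hv, rfl⟩
    rw [← hlow v hv]
    exact hdet v

end

theorem aux_valring {K : Type} [NontriviallyNormedField K]
    (R : Subring K) (hR : ∀ x : K, x ∈ R ↔ ‖x‖ ≤ 1) : ValuationRing R := by
  rw [ValuationRing.iff_dvd_total]
  have key : ∀ a b : R, ‖(b : K)‖ ≤ ‖(a : K)‖ → a ∣ b := by
    intro a b h
    by_cases ha : (a : K) = 0
    · have hb : (b : K) = 0 := by rw [ha] at h; simpa using h
      have : b = 0 := Subtype.ext hb
      rw [this]; exact dvd_zero _
    · refine ⟨⟨(b : K) / a, (hR _).2 ?_⟩, Subtype.ext ?_⟩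
      · rw [norm_div]
        exact div_le_one_of_le₀ h (norm_nonneg _)
      · simp only [Subring.coe_mul]
        field_simp
  exact ⟨fun a b => (le_total ‖(b : K)‖ ‖(a : K)‖).imp (key a b) (key b a)⟩

theorem aux_frac {K : Type} [NontriviallyNormedField K]
    (R : Subring K) (hR : ∀ x : K, x ∈ R ↔ ‖x‖ ≤ 1) : IsFractionRing R K := by
  have hinj : Function.Injective (algebraMap R K) := Subtype.val_injective
  refine IsFractionRing.of_field R K fun z => ?_
  by_cases h : ‖z‖ ≤ 1
  · exact ⟨⟨z, (hR z).2 h⟩, 1, by simp; rfl⟩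
  · refine ⟨1, ⟨z⁻¹, (hR _).2 ?_⟩, ?_⟩
    · rw [norm_inv]; exact inv_le_one_of_one_le₀ (le_of_not_ge h)
    · rw [map_one]
      change z = 1 / z⁻¹
      simp

theorem aux_lattice {K : Type} [NontriviallyNormedField K]
    (R : Subring K) (hR : ∀ x : K, x ∈ R ↔ ‖x‖ ≤ 1)
    {V : Type} [AddCommGroup V] [Module K V] (L : Submodule R V)
    (hspan : Submodule.span K (L : Set V) = ⊤) {ι : Type} (b : Module.Basis ι R L) :
    ∃ B : Module.Basis ι K V, (∀ i, B i = b i) ∧ L = Submodule.span R (Set.range B) := by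
  have := aux_frac R hR
  have hrange : L = Submodule.span R (Set.range fun i => (b i : V)) := by
    have := congrArg (Submodule.map L.subtype) b.span_eq
    rw [Submodule.map_span, Submodule.map_top, Submodule.range_subtype, ← Set.range_comp] at this
    exact this.symm
  have hli : LinearIndependent K (fun i => (b i : V)) := by
    rw [← LinearIndependent.iff_fractionRing R K]
    exact b.linearIndependent.map' L.subtype (Submodule.ker_subtype L)
  have hsp : ⊤ ≤ Submodule.span K (Set.range fun i => (b i : V)) := by
    rw [← hspan, Submodule.span_le]
    intro x hx
    have hx : x ∈ L := hx
    rw [hrange] at hx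
    exact Submodule.span_le_restrictScalars R K _ hx
  refine ⟨Module.Basis.mk hli hsp, fun i => by simp, ?_⟩
  rw [Module.Basis.coe_mk]
  exact hrange

theorem aux_basis {K : Type} [NontriviallyNormedField K]
    (R : Subring K) (hR : ∀ x : K, x ∈ R ↔ ‖x‖ ≤ 1)
    {V : Type} [AddCommGroup V] [Module K V] (N : ℕ) (hdim : Module.finrank K V = N)
    (L : Submodule R V) (hfg : L.FG)
    (hspan : Submodule.span K (L : Set V) = ⊤) : Nonempty (Module.Basis (Fin N) R L) := by
  have := aux_valring R hR
  have := aux_frac R hR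
  have : Module.Finite R L := Module.Finite.iff_fg.2 hfg
  have : Module.IsTorsionFree R V := Module.IsTorsionFree.trans_faithfulSMul R K V
  have : Module.Free R L := aux_free L
  let b := Module.Free.chooseBasis R L
  obtain ⟨B, -, -⟩ := aux_lattice R hR L hspan b
  have hc := Module.finrank_eq_card_basis B
  exact ⟨b.reindex (Fintype.equivFinOfCardEq (hc.symm.trans hdim))⟩

theorem aux_quot {R : Type} [CommRing R] {M M' : Type} [AddCommGroup M] [Module R M]
    [AddCommGroup M'] [Module R M'] {n : ℕ} (e : Module.Basis (Fin n) R M)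
    (e' : Module.Basis (Fin n) R M') (f : M' →ₗ[R] M) (a : Fin n → R)
    (hf : ∀ i, f (e' i) = a i • e i) (S : Submodule R M) (hS : S = LinearMap.range f) :
    Nonempty ((M ⧸ S) ≃ₗ[R] ((i : Fin n) → R ⧸ Ideal.span {a i})) := by
  let g : M →ₗ[R] ((i : Fin n) → R ⧸ Ideal.span {a i}) :=
    LinearMap.pi fun i => (Submodule.mkQ (Ideal.span {a i})) ∘ₗ e.coord i
  have hg : Function.Surjective g := by
    intro y
    choose r hr using fun i => Submodule.Quotient.mk_surjective (Ideal.span {a i}) (y i)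
    refine ⟨∑ i, r i • e i, funext fun i => ?_⟩
    rw [← hr i]
    have h : e.coord i (∑ j, r j • e j) = r i := by simp [Finsupp.single_apply]
    change Submodule.Quotient.mk (e.coord i (∑ j, r j • e j)) = _
    rw [h]
  have hfr : ∀ c : Fin n → R, f (∑ i, c i • e' i) = ∑ i, (a i * c i) • e i := by
    intro c
    simp [hf, smul_smul, mul_comm]
  have hk : LinearMap.ker g = S := by
    ext x
    have h1 : x ∈ LinearMap.ker g ↔ ∀ i, a i ∣ e.repr x i := by
      rw [LinearMap.mem_ker, funext_iff]
      refine forall_congr' fun i => ?_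
      rw [← Ideal.mem_span_singleton]
      exact Submodule.Quotient.mk_eq_zero _
    rw [h1, hS]
    constructor
    · intro h
      choose c hc using h
      refine ⟨∑ i, c i • e' i, ?_⟩
      rw [hfr]
      conv_rhs => rw [← e.sum_repr x]
      simp [hc]
    · rintro ⟨y, rfl⟩ i
      rw [← e'.sum_repr y, hfr]
      simp [Finsupp.single_apply]
  exact ⟨(Submodule.quotEquivOfEq _ _ hk.symm).trans (g.quotKerEquivOfSurjective hg)⟩

theorem aux_line {K : Type} [Field K] {V : Type} [AddCommGroup V] [Module K V] {N : ℕ}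
    (b : Module.Basis (Fin N) K V) (τ : ⋀[K]^N V) :
    ∃ c : K, (τ : ExteriorAlgebra K V) = c • ExteriorAlgebra.ιMulti K N b := by
  have h : τ ∈ Submodule.span K (Set.range (exteriorPower.ιMulti K N (M := V))) := by
    rw [exteriorPower.ιMulti_span]; trivial
  induction h using Submodule.span_induction with
  | mem x hx =>
    obtain ⟨v, rfl⟩ := hx
    exact ⟨b.det v, aux_alt b (ExteriorAlgebra.ιMulti K N) v⟩
  | zero => exact ⟨0, by simp⟩
  | add x y _ _ hx hy =>
    obtain ⟨c, hc⟩ := hx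
    obtain ⟨d, hd⟩ := hy
    exact ⟨c + d, by rw [add_smul, ← hc, ← hd]; rfl⟩
  | smul r x _ hx =>
    obtain ⟨c, hc⟩ := hx
    exact ⟨r * c, by rw [mul_smul, ← hc]; rfl⟩

/-- **Relative volume of nested lattices equals the content** (see 2.13 of the
paper).  `K` is a complete, non-trivially valued non-Archimedean field with
valuation ring `R = K° = {x : ‖x‖ ≤ 1}`, and `V` is an `N`-dimensional
`K`-vector space.  For a norm `ν` on `V`, the determinant norm on `Λ^N V` is
`‖τ‖_det = inf{ν(v₁)⋯ν(v_N) : τ = v₁ ∧ ⋯ ∧ v_N}`.  If `𝒱₁ ⊇ 𝒱₂` are lattices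
in `V` with lattice norms `ν₁, ν₂` (where `‖v‖_𝒱 = inf{‖α‖ : α ∈ K, v ∈ α𝒱}`),
then for every non-zero `τ` in the determinant line `Λ^N V` one has
`log(det ν₂ (τ) / det ν₁ (τ)) = ℓ(𝒱₁/𝒱₂)`, the content of the finitely
presented torsion module `𝒱₁/𝒱₂`. -/
theorem stmt7 (K : Type) [NontriviallyNormedField K] [IsUltrametricDist K]
    [CompleteSpace K]
    (R : Subring K) (hR : ∀ x : K, x ∈ R ↔ ‖x‖ ≤ 1)
    -- the content of (finitely presented torsion) K°-modules:
    (ℓ : (M : Type) → [AddCommGroup M] → [Module R M] → ℝ)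
    (hiso : ∀ (M N : Type) [AddCommGroup M] [Module R M] [AddCommGroup N] [Module R N],
        (M ≃ₗ[R] N) → ℓ M = ℓ N)
    (hval : ∀ (k : ℕ) (a : Fin k → R), (∀ i, (a i : K) ≠ 0) →
        ℓ ((i : Fin k) → R ⧸ Ideal.span {a i}) = ∑ i, -Real.log ‖(a i : K)‖)
    -- an N-dimensional K-vector space:
    (V : Type) [AddCommGroup V] [Module K V] (N : ℕ)
    (hdim : Module.finrank K V = N)
    -- nested lattices 𝒱₁ ⊇ 𝒱₂ in V:
    (𝒱₁ 𝒱₂ : Submodule R V) (h21 : 𝒱₂ ≤ 𝒱₁)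
    (hfg : 𝒱₁.FG ∧ 𝒱₂.FG)
    (hspan : Submodule.span K (𝒱₁ : Set V) = ⊤ ∧ Submodule.span K (𝒱₂ : Set V) = ⊤)
    -- the associated lattice norms on V:
    (ν₁ ν₂ : V → ℝ)
    (hν₁ : ∀ v : V, ν₁ v = sInf {c : ℝ | ∃ α : K, v ∈ α • (𝒱₁ : Set V) ∧ c = ‖α‖})
    (hν₂ : ∀ v : V, ν₂ v = sInf {c : ℝ | ∃ α : K, v ∈ α • (𝒱₂ : Set V) ∧ c = ‖α‖})
    -- the induced determinant norms on the determinant line Λ^N V: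
    (detν₁ detν₂ : ⋀[K]^N V → ℝ)
    (hdet₁ : ∀ τ : ⋀[K]^N V, detν₁ τ = sInf {c : ℝ | ∃ v : Fin N → V,
      (τ : ExteriorAlgebra K V) = ExteriorAlgebra.ιMulti K N v ∧ c = ∏ i, ν₁ (v i)})
    (hdet₂ : ∀ τ : ⋀[K]^N V, detν₂ τ = sInf {c : ℝ | ∃ v : Fin N → V,
      (τ : ExteriorAlgebra K V) = ExteriorAlgebra.ιMulti K N v ∧ c = ∏ i, ν₂ (v i)}) :
    ∀ τ : ⋀[K]^N V, τ ≠ 0 →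
      Real.log (detν₂ τ / detν₁ τ)
        = ℓ (↥𝒱₁ ⧸ Submodule.comap 𝒱₁.subtype 𝒱₂) := by
  intro τ hτ
  have := aux_valring R hR
  obtain ⟨c₁⟩ := aux_basis R hR N hdim 𝒱₁ hfg.1 hspan.1
  obtain ⟨c₂⟩ := aux_basis R hR N hdim 𝒱₂ hfg.2 hspan.2
  obtain ⟨e₁, e₂, a, hea⟩ := aux_bases c₁ c₂ (Submodule.inclusion h21)
  obtain ⟨B₁, hB₁, hL₁⟩ := aux_lattice R hR 𝒱₁ hspan.1 e₁
  obtain ⟨B₂, hB₂, hL₂⟩ := aux_lattice R hR 𝒱₂ hspan.2 e₂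
  have hBB : ∀ i, B₂ i = (a i : K) • B₁ i := by
    intro i
    rw [hB₁, hB₂]
    exact congrArg Subtype.val (hea i)
  have ha : ∀ i, (a i : K) ≠ 0 := by
    intro i h
    apply B₂.ne_zero i
    rw [hBB, h, zero_smul]
  obtain ⟨E⟩ := aux_quot e₁ e₂ (Submodule.inclusion h21) a hea
    (Submodule.comap 𝒱₁.subtype 𝒱₂) (Submodule.range_inclusion _ _ h21).symm
  have hl : ℓ (↥𝒱₁ ⧸ Submodule.comap 𝒱₁.subtype 𝒱₂) = ∑ i, -Real.log ‖(a i : K)‖ :=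
    (hiso _ _ E).trans (hval N a ha)
  rw [hl]
  cases N with
  | zero =>
    have : detν₂ τ = detν₁ τ := by
      rw [hdet₁, hdet₂]
      simp
    rw [this]
    by_cases h0 : detν₁ τ = 0 <;> simp [h0]
  | succ N =>
    obtain ⟨c, hc⟩ := aux_line B₂ τ
    have hc0 : c ≠ 0 := by
      rintro rfl
      apply hτ
      apply Subtype.ext
      rw [hc, zero_smul]
      rfl
    have hc1 : (τ : ExteriorAlgebra K V) =
        (c * ∏ i, (a i : K)) • ExteriorAlgebra.ιMulti K (N+1) B₁ := by
      rw [hc, mul_smul, ← AlternatingMap.map_smul_univ]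
      congr 2
      exact funext hBB
    have d1 := aux_detnorm R hR B₁ 𝒱₁ hL₁ ν₁ hν₁ τ _ hc1
    have d2 := aux_detnorm R hR B₂ 𝒱₂ hL₂ ν₂ hν₂ τ _ hc
    rw [hdet₁, hdet₂, d1, d2, norm_mul, norm_prod, Finset.sum_neg_distrib,
      ← Real.log_prod (fun i _ => norm_ne_zero_iff.2 (ha i)), ← Real.log_inv]
    congr 1
    have := norm_ne_zero_iff.2 hc0
    field_simp
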